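/- arXiv:1904.09534 — 2 statements merged into one kernel-verified Lean document; each statement's English description precedes it below -/
import Mathlib

section
/- For the Gaussian window, i.e. ĥ(ξ) = exp(−2π²ξ²): γ₀(0) = 1/(2√π), γ₁(0) = 0, and 4π² γ₂(0) = 1/(4√π); and for every η ∈ ℝ: ν₀(2η) = exp(−4π²η²)/(2√π), 2πi·(2η·ν₀(2η) − ν₁(2η)) = 2πiη · exp(−4π²η²)/(2√π), and −4π²·(2η·ν₁(2η) − ν₂(2η)) = (1/2 − 4π²η²) · exp(−4π²η²)/(2√π). Equivalently, the covariance and pseudocovariance matrices of the paper specialize to Γ_η = (2√π)⁻¹ · !![1, 0; 0, 1/2] and C_η = (exp(−4π²η²)/(2√π)) · !![1, 2πiη; 2πiη, 1/2 − 4π²η²]. (Paper's Corollary on the noise structure for the Gaussian window.) -/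
open MeasureTheory Complex Real

noncomputable section

/-- The Fourier transform of the Gaussian window: `ĥ(ξ) = exp(−2π²ξ²)`. -/
def hhat (ξ : ℝ) : ℝ := Real.exp (-2 * Real.pi ^ 2 * ξ ^ 2)

/-- `γ_k(s) = ∫ ξ^k · ĥ(ξ − s) · ĥ(ξ) dξ` for the Gaussian window. -/
def gammaK (k : ℕ) (s : ℝ) : ℝ := ∫ ξ : ℝ, ξ ^ k * hhat (ξ - s) * hhat ξ

/-- `ν_k(s) = ∫ ξ^k · ĥ(ξ) · ĥ(s − ξ) dξ` for the Gaussian window. -/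
def nuK (k : ℕ) (s : ℝ) : ℝ := ∫ ξ : ℝ, ξ ^ k * hhat ξ * hhat (s - ξ)

theorem integrable_sq_mul_exp_neg_mul_sq {b : ℝ} (hb : 0 < b) :
    Integrable fun x : ℝ => x ^ 2 * Real.exp (-b * x ^ 2) := by
  have h := integrable_rpow_mul_exp_neg_mul_sq hb (s := 2) (by norm_num)
  simpa only [Real.rpow_two] using h

theorem hasDerivAt_exp_neg_mul_sq (b x : ℝ) :
    HasDerivAt (fun y : ℝ => Real.exp (-b * y ^ 2))
      (-2 * b * (x * Real.exp (-b * x ^ 2))) x := by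
  convert! (((hasDerivAt_id x).pow 2).const_mul (-b)).exp using 1
  simp
  ring

theorem integral_mul_exp_neg_mul_sq_eq_zero {b : ℝ} (hb : 0 < b) :
    ∫ x : ℝ, x * Real.exp (-b * x ^ 2) = 0 := by
  have h := integral_eq_zero_of_hasDerivAt_of_integrable
    (hasDerivAt_exp_neg_mul_sq b)
    ((integrable_mul_exp_neg_mul_sq hb).const_mul _) (integrable_exp_neg_mul_sq hb)
  rw [integral_const_mul] at h
  exact (mul_eq_zero.mp h).resolve_left (by nlinarith)

theorem integral_sq_mul_exp_neg_mul_sq {b : ℝ} (hb : 0 < b) :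
    ∫ x : ℝ, x ^ 2 * Real.exp (-b * x ^ 2) = √(π / b) / (2 * b) := by
  have hd (x : ℝ) : HasDerivAt (fun y : ℝ => y * Real.exp (-b * y ^ 2))
      (Real.exp (-b * x ^ 2) - 2 * b * (x ^ 2 * Real.exp (-b * x ^ 2))) x := by
    convert! (hasDerivAt_id x).mul (hasDerivAt_exp_neg_mul_sq b x) using 1
    simp
    ring
  have hi := (integrable_sq_mul_exp_neg_mul_sq hb).const_mul (2 * b)
  have h := integral_eq_zero_of_hasDerivAt_of_integrable hd
    ((integrable_exp_neg_mul_sq hb).sub hi) (integrable_mul_exp_neg_mul_sq hb)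
  rw [integral_sub (integrable_exp_neg_mul_sq hb) hi, integral_const_mul,
    integral_gaussian] at h
  rw [eq_div_iff (by positivity)]
  linarith

theorem nuK_two_mul (k : ℕ) (η : ℝ) :
    nuK k (2 * η) = Real.exp (-4 * π ^ 2 * η ^ 2) *
      ∫ x : ℝ, (x + η) ^ k * Real.exp (-(4 * π ^ 2) * x ^ 2) := by
  rw [nuK, ← integral_add_right_eq_self _ η, ← integral_const_mul]
  congr 1 with x
  rw [hhat, hhat, mul_assoc, ← Real.exp_add, mul_left_comm, ← Real.exp_add]
  ring_nf

theorem gammaK_zero_right (k : ℕ) : gammaK k 0 = nuK k 0 := by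
  simp only [gammaK, nuK, hhat, sub_zero, zero_sub, neg_sq]

theorem sqrt_pi_div_four_mul_pi_sq : √(π / (4 * π ^ 2)) = 1 / (2 * √π) := by
  have h : π / (4 * π ^ 2) = (1 / 2) ^ 2 / π := by
    field_simp
    norm_num
  rw [h, Real.sqrt_div (by positivity), Real.sqrt_sq (by norm_num)]
  field_simp

theorem nuK_zero_two_mul (η : ℝ) :
    nuK 0 (2 * η) = Real.exp (-4 * π ^ 2 * η ^ 2) / (2 * √π) := by
  simp only [nuK_two_mul, pow_zero, one_mul]
  rw [integral_gaussian, sqrt_pi_div_four_mul_pi_sq, mul_one_div]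

theorem nuK_one_two_mul (η : ℝ) :
    nuK 1 (2 * η) = η * (Real.exp (-4 * π ^ 2 * η ^ 2) / (2 * √π)) := by
  have hb : 0 < 4 * π ^ 2 := by positivity
  simp only [nuK_two_mul, pow_one, add_mul]
  rw [integral_add (integrable_mul_exp_neg_mul_sq hb)
    ((integrable_exp_neg_mul_sq hb).const_mul η), integral_const_mul,
    integral_mul_exp_neg_mul_sq_eq_zero hb, integral_gaussian, sqrt_pi_div_four_mul_pi_sq]
  ring

theorem nuK_two_two_mul (η : ℝ) :
    nuK 2 (2 * η) =
      (η ^ 2 + 1 / (8 * π ^ 2)) * (Real.exp (-4 * π ^ 2 * η ^ 2) / (2 * √π)) := by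
  have hb : 0 < 4 * π ^ 2 := by positivity
  have hi₀ := (integrable_exp_neg_mul_sq hb).const_mul (η ^ 2)
  have hi₁ := (integrable_mul_exp_neg_mul_sq hb).const_mul (2 * η)
  have hi₂ := integrable_sq_mul_exp_neg_mul_sq hb
  have hx (x : ℝ) : (x + η) ^ 2 * Real.exp (-(4 * π ^ 2) * x ^ 2) =
      x ^ 2 * Real.exp (-(4 * π ^ 2) * x ^ 2) +
        (2 * η * (x * Real.exp (-(4 * π ^ 2) * x ^ 2)) +
          η ^ 2 * Real.exp (-(4 * π ^ 2) * x ^ 2)) := by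
    ring
  simp only [nuK_two_mul, hx]
  rw [integral_add hi₂ (hi₁.fun_add hi₀), integral_add hi₁ hi₀, integral_const_mul,
    integral_const_mul, integral_sq_mul_exp_neg_mul_sq hb,
    integral_mul_exp_neg_mul_sq_eq_zero hb, integral_gaussian, sqrt_pi_div_four_mul_pi_sq]
  ring

/-- **Noise structure for the Gaussian window.**
`γ₀(0) = 1/(2√π)`, `γ₁(0) = 0`, `4π²γ₂(0) = 1/(4√π)`, and for all `η`,
`ν₀(2η) = e^{−4π²η²}/(2√π)`, `2πi(2η·ν₀(2η) − ν₁(2η)) = 2πiη·e^{−4π²η²}/(2√π)`, and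
`−4π²(2η·ν₁(2η) − ν₂(2η)) = (1/2 − 4π²η²)·e^{−4π²η²}/(2√π)`; i.e. the covariance and
pseudocovariance matrices specialize to `Γ_η = (2√π)⁻¹·!![1,0;0,1/2]` and
`C_η = (e^{−4π²η²}/(2√π))·!![1, 2πiη; 2πiη, 1/2 − 4π²η²]`. -/
theorem gaussian_window_noise_structure :
    gammaK 0 0 = 1 / (2 * Real.sqrt Real.pi) ∧
    gammaK 1 0 = 0 ∧
    4 * Real.pi ^ 2 * gammaK 2 0 = 1 / (4 * Real.sqrt Real.pi) ∧
    (∀ η : ℝ,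
      nuK 0 (2 * η) =
        Real.exp (-4 * Real.pi ^ 2 * η ^ 2) / (2 * Real.sqrt Real.pi) ∧
      2 * (Real.pi : ℂ) * Complex.I *
          ((2 * η * nuK 0 (2 * η) - nuK 1 (2 * η) : ℝ) : ℂ) =
        2 * (Real.pi : ℂ) * Complex.I * (η : ℂ) *
          ((Real.exp (-4 * Real.pi ^ 2 * η ^ 2) / (2 * Real.sqrt Real.pi) : ℝ) : ℂ) ∧
      -4 * Real.pi ^ 2 * (2 * η * nuK 1 (2 * η) - nuK 2 (2 * η)) =
        (1 / 2 - 4 * Real.pi ^ 2 * η ^ 2) *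
          (Real.exp (-4 * Real.pi ^ 2 * η ^ 2) / (2 * Real.sqrt Real.pi))) := by
  have h₀ := nuK_zero_two_mul 0
  have h₁ := nuK_one_two_mul 0
  have h₂ := nuK_two_two_mul 0
  simp only [mul_zero, zero_mul, ne_eq, OfNat.ofNat_ne_zero, not_false_eq_true, zero_pow,
    Real.exp_zero, zero_add] at h₀ h₁ h₂
  refine ⟨by rw [gammaK_zero_right, h₀], by rw [gammaK_zero_right, h₁], ?_, fun η =>
    ⟨nuK_zero_two_mul η, ?_, ?_⟩⟩
  · rw [gammaK_zero_right, h₂]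
    field_simp
    norm_num
  · rw [nuK_zero_two_mul, nuK_one_two_mul]
    push_cast
    ring
  · rw [nuK_one_two_mul, nuK_two_two_mul]
    field_simp
    ring

end
end

section
/- For every k ∈ ℕ there exists m ∈ (0, 1) such that for all real x > 0: m · max(1, exp(x²)·x^{k+3}) ≤ ₁F₁(k/2 + 2; 1/2; x²) ≤ m⁻¹ · max(1, exp(x²)·x^{k+3}). (Paper's supplementary Lemma giving two-sided bounds on the confluent hypergeometric function used to control the moments of the synchrosqueezing integrand.) -/
open Real

/-- The Kummer confluent hypergeometric function `₁F₁(a; b; x)`, defined by its power series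
`∑ₙ ((a)ₙ/(b)ₙ)·xⁿ/n!` where `(a)ₙ` is the rising factorial. -/
noncomputable def oneFOne (a b x : ℝ) : ℝ :=
  ∑' n : ℕ,
    ((∏ i ∈ Finset.range n, (a + i)) / (∏ i ∈ Finset.range n, (b + i))) * x ^ n / n.factorial

open Finset in
/-- Upper bound for a quotient of rising factorials, from Bernoulli's inequality. -/
lemma prod_add_div_prod_le_rpow {b p : ℝ} (hb : 0 < b) (hp : 1 ≤ p) (n : ℕ) :
    (∏ i ∈ range n, (b + p + i)) / (∏ i ∈ range n, (b + i)) ≤ (1 + n / b) ^ p := by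
  induction n with
  | zero => simp
  | succ n ih =>
    have hn : (0 : ℝ) ≤ n := n.cast_nonneg
    have hbn : 0 < b + n := by positivity
    have bern : 1 + p * (1 / (b + n)) ≤ (1 + 1 / (b + n)) ^ p :=
      one_add_mul_self_le_rpow_one_add (by linarith [show 0 < 1 / (b + n) by positivity]) hp
    have step : 1 + ((n + 1 : ℕ) : ℝ) / b = (1 + n / b) * (1 + 1 / (b + n)) := by
      push_cast; field_simp; ring
    rw [prod_range_succ, prod_range_succ, mul_div_mul_comm, step,
      Real.mul_rpow (by positivity) (by positivity)]
    have ratio : (b + p + n) / (b + n) = 1 + p * (1 / (b + n)) := by field_simp; ring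
    rw [ratio]
    exact mul_le_mul ih bern (by positivity) (by positivity)

open Finset in
/-- Lower bound for a quotient of rising factorials, from Bernoulli's inequality. -/
lemma rpow_le_prod_add_div_prod {b p : ℝ} (hb : 0 < b) (hp : 1 ≤ p) (n : ℕ) :
    (1 + n / (b + p - 1)) ^ p ≤ (∏ i ∈ range n, (b + p + i)) / (∏ i ∈ range n, (b + i)) := by
  induction n with
  | zero => simp
  | succ n ih =>
    have hn : (0 : ℝ) ≤ n := n.cast_nonneg
    have hs : 0 < b + p - 1 := by linarith
    have hbn : 0 < b + n := by positivity
    have hbpn : 0 < b + p + n := by positivity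
    have hle : 1 / (b + p + n) ≤ 1 := by rw [div_le_one hbpn]; linarith
    have bern : 1 + p * (-(1 / (b + p + n))) ≤ (1 + -(1 / (b + p + n))) ^ p :=
      one_add_mul_self_le_rpow_one_add (by linarith) hp
    have step : (1 + ((n + 1 : ℕ) : ℝ) / (b + p - 1)) * (1 + -(1 / (b + p + n))) =
        1 + n / (b + p - 1) := by
      push_cast; field_simp; ring
    have ratio : 1 + p * (-(1 / (b + p + n))) = (b + n) / (b + p + n) := by
      field_simp; ring
    rw [prod_range_succ, prod_range_succ, mul_div_mul_comm]
    rw [ratio] at bern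
    have hmul : (1 + ((n + 1 : ℕ) : ℝ) / (b + p - 1)) ^ p * ((b + n) / (b + p + n)) ≤
        (1 + n / (b + p - 1)) ^ p := by
      rw [← step, Real.mul_rpow (by positivity) (by linarith)]
      gcongr
    calc (1 + ((n + 1 : ℕ) : ℝ) / (b + p - 1)) ^ p
        = (1 + ((n + 1 : ℕ) : ℝ) / (b + p - 1)) ^ p * ((b + n) / (b + p + n)) *
            ((b + p + n) / (b + n)) := by field_simp
      _ ≤ _ := by gcongr; exact hmul.trans ih

/-- The exponential series as a real `HasSum`. -/
lemma hasSum_pow_div_factorial (y : ℝ) :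
    HasSum (fun n : ℕ => y ^ n / n.factorial) (Real.exp y) := by
  rw [Real.exp_eq_exp_ℝ]
  exact NormedSpace.expSeries_div_hasSum_exp y

/-- The factorial moments of the unnormalised Poisson weights. -/
lemma hasSum_descFactorial_mul_pow_div_factorial (r : ℕ) (y : ℝ) :
    HasSum (fun n : ℕ => (n.descFactorial r : ℝ) * (y ^ n / n.factorial))
      (y ^ r * Real.exp y) := by
  rw [← (add_left_injective r).hasSum_iff]
  · refine ((hasSum_pow_div_factorial y).mul_left (y ^ r)).congr_fun ?_
    intro n
    have h : (n.factorial : ℝ) * (n + r).descFactorial r = (n + r).factorial := by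
      have := Nat.factorial_mul_descFactorial (Nat.le_add_left r n)
      rw [Nat.add_sub_cancel] at this
      exact_mod_cast this
    have h₁ : ((n + r).factorial : ℝ) ≠ 0 := by positivity
    have h₂ : (n.factorial : ℝ) ≠ 0 := by positivity
    simp only [Function.comp_apply]
    field_simp
    rw [pow_add, ← h]
    ring
  · intro n hn
    have : n < r := by
      by_contra! hle
      exact hn ⟨n - r, Nat.sub_add_cancel hle⟩
    simp [Nat.descFactorial_of_lt this]

/-- Powers of `2 * n + 1` are controlled by falling factorials. -/
lemma two_mul_add_one_pow_le (r n : ℕ) :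
    (2 * n + 1) ^ r ≤ (4 * r + 1) ^ r + 4 ^ r * n.descFactorial r := by
  rcases lt_or_ge n (2 * r) with h | h
  · exact le_add_right (Nat.pow_le_pow_left (by omega) r)
  · refine le_add_left ?_
    calc (2 * n + 1) ^ r ≤ (4 * (n + 1 - r)) ^ r := Nat.pow_le_pow_left (by omega) r
      _ = 4 ^ r * (n + 1 - r) ^ r := mul_pow ..
      _ ≤ _ := by gcongr; exact Nat.pow_sub_le_descFactorial n r

/-- For nonnegative `t`, a real power is bounded by one plus a larger natural power. -/
lemma rpow_le_one_add_pow {t p : ℝ} {r : ℕ} (ht : 0 ≤ t) (hp : 0 ≤ p) (hpr : p ≤ r) :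
    t ^ p ≤ 1 + t ^ r := by
  rcases le_total t 1 with h | h
  · linarith [Real.rpow_le_one ht h hp, pow_nonneg ht r]
  · have := Real.rpow_le_rpow_of_exponent_le h hpr
    rw [Real.rpow_natCast] at this
    linarith

/-- Pointwise majorant of `(2 * n + 1) ^ p` by an affine function of the falling factorial. -/
lemma two_mul_add_one_rpow_le {p y : ℝ} {r : ℕ} (hp : 0 ≤ p) (hpr : p ≤ r) (hy : 0 ≤ y) (n : ℕ) :
    (1 + (n : ℝ) / (1 / 2)) ^ p ≤ (1 + y) ^ p *
      (1 + ((4 * r + 1) ^ r + 4 ^ r * n.descFactorial r) / (1 + y) ^ r) := by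
  have hv : 0 < 1 + y := by positivity
  have hcast : ((2 * n + 1 : ℝ)) ^ r ≤ (4 * r + 1) ^ r + 4 ^ r * n.descFactorial r := by
    exact_mod_cast two_mul_add_one_pow_le r n
  have heq : 1 + (n : ℝ) / (1 / 2) = (1 + y) * ((2 * n + 1) / (1 + y)) := by
    field_simp; ring
  rw [heq, Real.mul_rpow hv.le (by positivity)]
  gcongr
  refine (rpow_le_one_add_pow (by positivity) hp hpr).trans ?_
  rw [div_pow]
  gcongr

/-- The general term of the Kummer series. -/
noncomputable def oneFOneTerm (a b y : ℝ) (n : ℕ) : ℝ :=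
  ((∏ i ∈ Finset.range n, (a + i)) / (∏ i ∈ Finset.range n, (b + i))) * y ^ n / n.factorial

lemma oneFOneTerm_nonneg {a b y : ℝ} (ha : 0 ≤ a) (hb : 0 ≤ b) (hy : 0 ≤ y) (n : ℕ) :
    0 ≤ oneFOneTerm a b y n := by
  unfold oneFOneTerm
  have h₁ : 0 ≤ ∏ i ∈ Finset.range n, (a + i) := Finset.prod_nonneg fun i _ => by positivity
  have h₂ : 0 ≤ ∏ i ∈ Finset.range n, (b + i) := Finset.prod_nonneg fun i _ => by positivity
  positivity

/-- Summability of the Kummer series with `b = 1 / 2`, together with an upper bound. -/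
lemma summable_and_oneFOne_le {p y : ℝ} {r : ℕ} (hp : 1 ≤ p) (hpr : p ≤ r) (hy : 0 ≤ y) :
    Summable (oneFOneTerm (1 / 2 + p) (1 / 2) y) ∧
      oneFOne (1 / 2 + p) (1 / 2) y ≤
        (1 + (4 * r + 1) ^ r + 4 ^ r) * ((1 + y) ^ p * Real.exp y) := by
  have hv : 0 < 1 + y := by positivity
  set A : ℝ := (1 + y) ^ p * (1 + (4 * r + 1) ^ r / (1 + y) ^ r) with hA
  set B : ℝ := (1 + y) ^ p * (4 ^ r / (1 + y) ^ r) with hB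
  have hmaj : HasSum (fun n : ℕ => A * (y ^ n / n.factorial) +
      B * ((n.descFactorial r : ℝ) * (y ^ n / n.factorial)))
      (A * Real.exp y + B * (y ^ r * Real.exp y)) :=
    ((hasSum_pow_div_factorial y).mul_left A).add
      ((hasSum_descFactorial_mul_pow_div_factorial r y).mul_left B)
  have hle : ∀ n : ℕ, oneFOneTerm (1 / 2 + p) (1 / 2) y n ≤ A * (y ^ n / n.factorial) +
      B * ((n.descFactorial r : ℝ) * (y ^ n / n.factorial)) := by
    intro n
    have h := (prod_add_div_prod_le_rpow one_half_pos hp n).trans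
      (two_mul_add_one_rpow_le (by linarith) hpr hy n)
    have hw : 0 ≤ y ^ n / (n.factorial : ℝ) := by positivity
    unfold oneFOneTerm
    rw [mul_div_assoc]
    refine (mul_le_mul_of_nonneg_right h hw).trans_eq ?_
    rw [hA, hB]
    ring
  have hsum : Summable (oneFOneTerm (1 / 2 + p) (1 / 2) y) :=
    hmaj.summable.of_nonneg_of_le
      (oneFOneTerm_nonneg (by linarith) (by norm_num) hy) hle
  refine ⟨hsum, (hasSum_le hle hsum.hasSum hmaj).trans ?_⟩
  have h₁ : (4 * r + 1 : ℝ) ^ r / (1 + y) ^ r ≤ (4 * r + 1) ^ r :=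
    div_le_self (by positivity) (one_le_pow₀ (by linarith))
  have h₂ : (4 : ℝ) ^ r / (1 + y) ^ r * y ^ r ≤ 4 ^ r := by
    rw [div_mul_eq_mul_div, div_le_iff₀ (by positivity)]
    gcongr
    linarith
  calc A * Real.exp y + B * (y ^ r * Real.exp y)
      = (1 + (4 * r + 1) ^ r / (1 + y) ^ r + 4 ^ r / (1 + y) ^ r * y ^ r) *
          ((1 + y) ^ p * Real.exp y) := by rw [hA, hB]; ring
    _ ≤ _ := by gcongr

/-- Lower bound for the Kummer function, by Jensen's inequality for the Poisson weights. -/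
lemma rpow_mul_exp_le_oneFOne {b p y : ℝ} (hb : 0 < b) (hp : 1 ≤ p) (hy : 0 ≤ y)
    (hsum : Summable (oneFOneTerm (b + p) b y)) :
    (1 + y / (b + p - 1)) ^ p * Real.exp y ≤ oneFOne (b + p) b y := by
  set s := b + p - 1 with hs_def
  have hs : 0 < s := by linarith
  set v := 1 + y / s with hv_def
  have hv : 0 < v := by positivity
  have hmean : HasSum (fun n : ℕ => (n : ℝ) * (y ^ n / n.factorial)) (y * Real.exp y) := by
    simpa using hasSum_descFactorial_mul_pow_div_factorial 1 y
  have hmin : HasSum (fun n : ℕ => v ^ p * (1 - p + p / v) * (y ^ n / n.factorial) +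
      v ^ p * (p / (s * v)) * ((n : ℝ) * (y ^ n / n.factorial)))
      (v ^ p * (1 - p + p / v) * Real.exp y + v ^ p * (p / (s * v)) * (y * Real.exp y)) :=
    ((hasSum_pow_div_factorial y).mul_left _).add (hmean.mul_left _)
  have htotal : v ^ p * (1 - p + p / v) * Real.exp y + v ^ p * (p / (s * v)) * (y * Real.exp y) =
      v ^ p * Real.exp y := by
    have hy' : y = s * (v - 1) := by rw [hv_def]; field_simp; ring
    have : 1 - p + p / v + p / (s * v) * y = 1 := by
      rw [hy']; field_simp; ring
    linear_combination (v ^ p * Real.exp y) * this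
  rw [← htotal]
  refine hasSum_le (fun n => ?_) hmin hsum.hasSum
  have hn : (0 : ℝ) ≤ n := n.cast_nonneg
  have hu : 0 ≤ (1 + n / s) / v := by positivity
  have bern := one_add_mul_self_le_rpow_one_add
    (show -1 ≤ (1 + n / s) / v - 1 by linarith) hp
  rw [add_sub_cancel] at bern
  have h : v ^ p * (1 + p * ((1 + n / s) / v - 1)) ≤ (1 + n / s) ^ p := by
    calc v ^ p * (1 + p * ((1 + n / s) / v - 1)) ≤ v ^ p * ((1 + n / s) / v) ^ p := by gcongr
      _ = (1 + n / s) ^ p := by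
        rw [← Real.mul_rpow hv.le hu, mul_div_cancel₀ _ hv.ne']
  have hw : 0 ≤ y ^ n / (n.factorial : ℝ) := by positivity
  unfold oneFOneTerm
  rw [mul_div_assoc]
  refine Eq.trans_le ?_
    (mul_le_mul_of_nonneg_right (h.trans (rpow_le_prod_add_div_prod hb hp n)) hw)
  field_simp
  ring

/-- `(1 + y) ^ p * exp y` dominates `max 1 (exp y * y ^ p)`. -/
lemma max_one_exp_mul_rpow_le {p y : ℝ} (hp : 0 ≤ p) (hy : 0 ≤ y) :
    max 1 (Real.exp y * y ^ p) ≤ (1 + y) ^ p * Real.exp y := by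
  refine max_le ?_ ?_
  · exact one_le_mul_of_one_le_of_one_le (Real.one_le_rpow (by linarith) hp)
      (Real.one_le_exp hy)
  · rw [mul_comm]
    gcongr
    linarith

/-- `(1 + y) ^ p * exp y` is at most a constant times `max 1 (exp y * y ^ p)`. -/
lemma one_add_rpow_mul_exp_le {p y : ℝ} (hp : 0 ≤ p) (hy : 0 ≤ y) :
    (1 + y) ^ p * Real.exp y ≤ 2 ^ p * Real.exp 1 * max 1 (Real.exp y * y ^ p) := by
  rcases le_total y 1 with h | h
  · calc (1 + y) ^ p * Real.exp y ≤ 2 ^ p * Real.exp 1 * 1 := by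
          rw [mul_one]; gcongr; linarith
      _ ≤ _ := by gcongr; exact le_max_left _ _
  · calc (1 + y) ^ p * Real.exp y ≤ (2 * y) ^ p * Real.exp y := by gcongr; linarith
      _ = 2 ^ p * 1 * (Real.exp y * y ^ p) := by
          rw [Real.mul_rpow zero_le_two hy]; ring
      _ ≤ _ := by
          gcongr
          · exact Real.one_le_exp zero_le_one
          · exact le_max_right _ _

/-- **Two-sided bounds on `₁F₁(k/2 + 2; 1/2; x²)`.**
For every `k ∈ ℕ` there exists `m ∈ (0, 1)` such that for all `x > 0`,
`m·max(1, e^{x²}·x^{k+3}) ≤ ₁F₁(k/2+2; 1/2; x²) ≤ m⁻¹·max(1, e^{x²}·x^{k+3})`. -/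
theorem oneFOne_two_sided_bound (k : ℕ) :
    ∃ m : ℝ, m ∈ Set.Ioo (0 : ℝ) 1 ∧ ∀ x : ℝ, 0 < x →
      m * max 1 (Real.exp (x ^ 2) * x ^ (k + 3)) ≤ oneFOne ((k : ℝ) / 2 + 2) (1 / 2) (x ^ 2) ∧
      oneFOne ((k : ℝ) / 2 + 2) (1 / 2) (x ^ 2) ≤
        m⁻¹ * max 1 (Real.exp (x ^ 2) * x ^ (k + 3)) := by
  have hk : (0 : ℝ) ≤ k := k.cast_nonneg
  set p : ℝ := ((k : ℝ) + 3) / 2 with hp_def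
  have hp : 1 ≤ p := by rw [hp_def]; linarith
  have hp0 : 0 ≤ p := zero_le_one.trans hp
  have hpr : p ≤ (k + 3 : ℕ) := by rw [hp_def]; push_cast; linarith
  have ha : (k : ℝ) / 2 + 2 = 1 / 2 + p := by rw [hp_def]; ring
  set C : ℝ := 1 + (4 * (k + 3 : ℕ) + 1) ^ (k + 3) + 4 ^ (k + 3) with hC_def
  have hC : 0 < C := by positivity
  set D : ℝ := C * (2 ^ p * Real.exp 1) with hD_def
  have hD : 0 < D := by positivity
  set L : ℝ := (1 / 2 + p - 1) ^ p with hL_def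
  have hs : 1 ≤ 1 / 2 + p - 1 := by rw [hp_def]; linarith
  have hs0 : 0 < 1 / 2 + p - 1 := by linarith
  have hL : 0 < L := by positivity
  refine ⟨(1 + L + D)⁻¹, ⟨by positivity, inv_lt_one_of_one_lt₀ (by linarith)⟩, fun x hx => ?_⟩
  have hy : 0 ≤ x ^ 2 := sq_nonneg x
  have hpow : x ^ (k + 3) = (x ^ 2) ^ p := by
    rw [← Real.rpow_natCast x 2, ← Real.rpow_mul hx.le, ← Real.rpow_natCast]
    congr 1
    rw [hp_def]; push_cast; ring
  rw [ha, hpow, inv_inv]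
  obtain ⟨hsum, hupper⟩ := summable_and_oneFOne_le hp hpr hy
  have hlower := rpow_mul_exp_le_oneFOne one_half_pos hp hy hsum
  have hmax := max_one_exp_mul_rpow_le hp0 hy
  set M := max 1 (Real.exp (x ^ 2) * (x ^ 2) ^ p)
  have hM : 0 < M := lt_max_of_lt_left one_pos
  constructor
  · rw [inv_mul_le_iff₀ (by positivity)]
    have hbase : (1 + x ^ 2) ^ p ≤ L * (1 + x ^ 2 / (1 / 2 + p - 1)) ^ p := by
      rw [hL_def, ← Real.mul_rpow hs0.le (by positivity), mul_add, mul_div_cancel₀ _ hs0.ne']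
      gcongr
      linarith
    have hF : 0 ≤ oneFOne (1 / 2 + p) (1 / 2) (x ^ 2) := le_trans (by positivity) hlower
    calc M ≤ (1 + x ^ 2) ^ p * Real.exp (x ^ 2) := hmax
      _ ≤ L * (1 + x ^ 2 / (1 / 2 + p - 1)) ^ p * Real.exp (x ^ 2) := by gcongr
      _ = L * ((1 + x ^ 2 / (1 / 2 + p - 1)) ^ p * Real.exp (x ^ 2)) := mul_assoc _ _ _
      _ ≤ L * oneFOne (1 / 2 + p) (1 / 2) (x ^ 2) := by gcongr
      _ ≤ (1 + L + D) * oneFOne (1 / 2 + p) (1 / 2) (x ^ 2) := by gcongr; linarith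
  · calc oneFOne (1 / 2 + p) (1 / 2) (x ^ 2)
        ≤ C * ((1 + x ^ 2) ^ p * Real.exp (x ^ 2)) := hupper
      _ ≤ C * (2 ^ p * Real.exp 1 * M) :=
          mul_le_mul_of_nonneg_left (one_add_rpow_mul_exp_le hp0 hy) hC.le
      _ = D * M := by rw [hD_def]; ring
      _ ≤ (1 + L + D) * M := by gcongr; linarith
end
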